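/- arXiv:hep-th/0302159 — 8 statements merged into one kernel-verified Lean document; each statement's English description precedes it below -/
import Mathlib

section
/- Let S := {(e0, e1) ∈ ℝ² : the matrix Q(e0,e1) = [[1 − e0, −1], [−1, 1 + e1]] is positive definite}. Then: (a) S is a convex subset of ℝ²; (b) (0, 0) ∉ S; and consequently (c) for every n ≥ 1 and every finite family of points (e0⁽¹⁾, e1⁽¹⁾), …, (e0⁽ⁿ⁾, e1⁽ⁿ⁾) all lying in S, the sum Σᵢ (e0⁽ⁱ⁾, e1⁽ⁱ⁾) is not equal to (0, 0). (This is the paper's claim that, by convexity of the stable domain, electric gradients along several directions cannot all lie in the stable region while satisfying the tracelessness constraint Σᵢ(e0⁽ⁱ⁾, e1⁽ⁱ⁾) = (0,0).) -/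
theorem stable_aux (a b : ℝ) : (!![1 - a, -1; -1, 1 + b] : Matrix (Fin 2) (Fin 2) ℝ).PosDef ↔
    ∀ x : Fin 2 → ℝ, x ≠ 0 →
      0 < (1 - a) * x 0 ^ 2 - 2 * x 0 * x 1 + (1 + b) * x 1 ^ 2 := by
  have key : ∀ x : Fin 2 → ℝ,
      star x ⬝ᵥ (!![1 - a, -1; -1, 1 + b] : Matrix (Fin 2) (Fin 2) ℝ).mulVec x =
        (1 - a) * x 0 ^ 2 - 2 * x 0 * x 1 + (1 + b) * x 1 ^ 2 := by
    intro x
    simp [dotProduct, Matrix.mulVec, Fin.sum_univ_two]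
    ring
  rw [Matrix.posDef_iff_dotProduct_mulVec]
  constructor
  · rintro ⟨-, h⟩ x hx
    rw [← key]
    exact h hx
  · intro h
    refine ⟨?_, fun x hx => ?_⟩
    · ext i j
      fin_cases i <;> fin_cases j <;> simp
    · rw [key]
      exact h x hx

theorem stable_lt (a b : ℝ)
    (h : (!![1 - a, -1; -1, 1 + b] : Matrix (Fin 2) (Fin 2) ℝ).PosDef) : a < b := by
  have := (stable_aux a b).1 h (fun _ => 1) (fun h => one_ne_zero (congrFun h 0))
  norm_num at this
  linarith


/-- The stable domain `S` (where `Q(e0,e1) = [[1-e0,-1],[-1,1+e1]]` is positive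
definite) is convex, does not contain `(0,0)`, and hence no finite family of
points of `S` can sum to `(0,0)` (tracelessness obstruction). -/
theorem stable_domain_convex_and_traceless_obstruction :
    let Q : ℝ → ℝ → Matrix (Fin 2) (Fin 2) ℝ := fun e0 e1 => !![1 - e0, -1; -1, 1 + e1]
    let S : Set (ℝ × ℝ) := {p : ℝ × ℝ | (Q p.1 p.2).PosDef}
    Convex ℝ S ∧ ((0, 0) : ℝ × ℝ) ∉ S ∧
      ∀ n : ℕ, 1 ≤ n → ∀ e : Fin n → ℝ × ℝ, (∀ i, e i ∈ S) →
        (∑ i, e i) ≠ (0, 0) := by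
  intro Q S
  refine ⟨?_, ?_, ?_⟩
  · intro p hp q hq s t hs ht hst
    have hp' := (stable_aux p.1 p.2).1 hp
    have hq' := (stable_aux q.1 q.2).1 hq
    refine (stable_aux _ _).2 fun x hx => ?_
    have h1 := hp' x hx
    have h2 := hq' x hx
    have h3 := (convex_Ioi (0 : ℝ)) h1 h2 hs ht hst
    simp only [Set.mem_Ioi, smul_eq_mul] at h3
    have ht' : t = 1 - s := by linarith
    subst ht'
    simp only [Prod.fst_add, Prod.snd_add, Prod.smul_fst, Prod.smul_snd, smul_eq_mul]
    linarith
  · intro h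
    exact lt_irrefl _ (stable_lt 0 0 h)
  · intro n hn e he hsum
    have h1 : ∑ i, (e i).1 = 0 := by rw [← Prod.fst_sum, hsum]
    have h2 : ∑ i, (e i).2 = 0 := by rw [← Prod.snd_sum, hsum]
    have : ∑ i, (e i).1 < ∑ i, (e i).2 :=
      Finset.sum_lt_sum_of_nonempty ⟨⟨0, hn⟩, Finset.mem_univ _⟩
        fun i _ => stable_lt _ _ (he i)
    linarith
end

section
/- Let e0, e1, x0, p0 be real numbers with (x0, p0) ≠ (0, 0), and define X : ℝ × [0, π] → ℝ by X(τ, σ) = (x0 + p0·τ)·(1 − (e0/π)·σ). Then: (a) X satisfies the wave equation ∂²τ X − ∂²σ X = 0 everywhere; (b) the boundary condition ∂σX(τ, 0) + (e0/π)·X(τ, 0) = 0 holds for all τ; and (c) the boundary condition ∂σX(τ, π) + (e1/π)·X(τ, π) = 0 holds for all τ if and only if e1 − e0 − e0·e1 = 0. (Macroscopic open strings of arbitrary size exist exactly at the critical electric gradient D = 0.) -/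
open Real

/-- The profile `X(τ,σ) = (x0 + p0 τ)(1 - (e0/π)σ)` satisfies the wave equation
and the Robin boundary condition at `σ = 0`, and it satisfies the Robin
boundary condition at `σ = π` if and only if `e1 - e0 - e0·e1 = 0`
(macroscopic strings exist exactly at the critical electric gradient). -/
theorem macroscopic_string_iff_critical_gradient (e0 e1 x0 p0 : ℝ)
    (h : (x0, p0) ≠ (0, 0)) (X : ℝ → ℝ → ℝ)
    (hX : ∀ τ σ : ℝ, X τ σ = (x0 + p0 * τ) * (1 - (e0 / π) * σ)) :
    (∀ τ σ : ℝ,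
      deriv (deriv (fun t => X t σ)) τ - deriv (deriv (fun s => X τ s)) σ = 0) ∧
    (∀ τ : ℝ, deriv (fun s => X τ s) 0 + (e0 / π) * X τ 0 = 0) ∧
    ((∀ τ : ℝ, deriv (fun s => X τ s) π + (e1 / π) * X τ π = 0) ↔
      e1 - e0 - e0 * e1 = 0) := by
  have hs : ∀ τ : ℝ, deriv (fun s => X τ s) = fun _ => (x0 + p0 * τ) * (-(e0 / π)) := by
    intro τ
    funext s
    have h1 : HasDerivAt (fun s => (x0 + p0 * τ) * (1 - (e0 / π) * s))
        ((x0 + p0 * τ) * (-((e0 / π) * 1))) s :=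
      (((hasDerivAt_id s).const_mul (e0 / π)).const_sub 1).const_mul (x0 + p0 * τ)
    simp only [hX]
    rw [h1.deriv, mul_one]
  have ht : ∀ σ : ℝ, deriv (fun t => X t σ) = fun _ => p0 * (1 - (e0 / π) * σ) := by
    intro σ
    funext t
    have h1 : HasDerivAt (fun t => (x0 + p0 * t) * (1 - (e0 / π) * σ))
        ((p0 * 1) * (1 - (e0 / π) * σ)) t :=
      (((hasDerivAt_id t).const_mul p0).const_add x0).mul_const _
    simp only [hX]
    rw [h1.deriv, mul_one]
  have hpi : π ≠ 0 := Real.pi_ne_zero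
  have key : ∀ τ : ℝ, deriv (fun s => X τ s) π + (e1 / π) * X τ π =
      (x0 + p0 * τ) * (e1 - e0 - e0 * e1) / π := by
    intro τ
    rw [hs, hX]
    field_simp
    ring
  refine ⟨?_, ?_, ?_, ?_⟩
  · intro τ σ
    rw [hs, ht]
    simp
  · intro τ
    rw [hs, hX]
    ring
  · intro hb
    by_contra hD
    have hz : ∀ τ : ℝ, x0 + p0 * τ = 0 := by
      intro τ
      have h2 := hb τ
      rw [key] at h2
      rcases div_eq_zero_iff.mp h2 with h3 | h3
      · exact (mul_eq_zero.mp h3).resolve_right hD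
      · exact absurd h3 hpi
    have h0 := hz 0
    have h1 := hz 1
    apply h
    rw [Prod.mk.injEq]
    constructor <;> linarith
  · intro hD τ
    rw [key, hD]
    simp
end

section
/- Let e0, e1 be real numbers with e0 ≠ e1, and define f(ω) := ((πω)² + e0·e1)·sin(πω) − (e1 − e0)·(πω)·cos(πω). Then for every integer n ≥ 1 there exists a real number ω ∈ (n, n+1) with f(ω) = 0. (The open string dispersion relation has a real eigenmode ωₙ in each interval between consecutive positive integers.) -/
open Real

/-- For `e0 ≠ e1`, the open string secular function
`f(ω) = ((πω)² + e0 e1) sin(πω) - (e1-e0)(πω) cos(πω)` has a root in each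
interval `(n, n+1)` for every integer `n ≥ 1`. -/
theorem secular_root_in_each_interval (e0 e1 : ℝ) (hne : e0 ≠ e1)
    (n : ℕ) (hn : 1 ≤ n) :
    ∃ ω : ℝ, ω ∈ Set.Ioo (n : ℝ) ((n : ℝ) + 1) ∧
      ((π * ω) ^ 2 + e0 * e1) * Real.sin (π * ω)
        - (e1 - e0) * (π * ω) * Real.cos (π * ω) = 0 := by
  have hd : e1 - e0 ≠ 0 := sub_ne_zero.mpr (Ne.symm hne)
  have hd2 : 0 < (e1 - e0) ^ 2 := by positivity
  have hn' : (0 : ℝ) < n := by exact_mod_cast hn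
  have hs : ∀ m : ℕ, Real.sin (π * m) = 0 := fun m => by
    rw [mul_comm]; exact Real.sin_nat_mul_pi m
  have hc : ∀ m : ℕ, Real.cos (π * m) = (-1) ^ m := fun m => by
    rw [mul_comm]; exact Real.cos_nat_mul_pi m
  have hsq : ((-1 : ℝ) ^ n) * (-1) ^ n = 1 := by
    rw [← mul_pow]; norm_num
  let g : ℝ → ℝ := fun ω => ((e1 - e0) * (-1) ^ n) *
    (((π * ω) ^ 2 + e0 * e1) * Real.sin (π * ω)
        - (e1 - e0) * (π * ω) * Real.cos (π * ω))
  have hg : Continuous g := by fun_prop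
  have h0 : g n < 0 := by
    have : g n = -((e1 - e0) ^ 2 * (π * n)) := by
      simp only [g, hs, hc]
      linear_combination (-(e1 - e0) ^ 2 * (π * n)) * hsq
    rw [this]
    have : 0 < (e1 - e0) ^ 2 * (π * n) := by positivity
    linarith
  have h1 : 0 < g ((n : ℝ) + 1) := by
    have : g ((n : ℝ) + 1) = (e1 - e0) ^ 2 * (π * (n + 1)) := by
      have a := hs (n + 1)
      have b := hc (n + 1)
      push_cast at a b
      simp only [g, a, b, pow_succ (-1 : ℝ) n]
      linear_combination ((e1 - e0) ^ 2 * (π * (n + 1))) * hsq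
    rw [this]
    positivity
  obtain ⟨ω, hω, h⟩ := intermediate_value_Ioo (by linarith : (n : ℝ) ≤ n + 1)
    hg.continuousOn ⟨h0, h1⟩
  refine ⟨ω, hω, ?_⟩
  exact (mul_eq_zero.mp h).resolve_left (mul_ne_zero hd (by positivity))
end

section
/- Let e0, e1 be real numbers and define, for real y, F(y) := (y² + 4·e0·e1)·(cos y − 1) − 2·(e0 − e1)·y·sin y and G(y) := (y² + 4·e0·e1)·sin y + 2·(e0 − e1)·y·(1 + cos y), the real and imaginary parts of Δ(iy) where Δ(z) := (4·e0·e1 − z²)·(exp(z) − 1) − 2·(e1 − e0)·z·(exp(z) + 1). Then for all real y, G'(y)·F(y) − G(y)·F'(y) = 2·[ (y² + 4·e0·e1)·sin(y/2) + 2·(e0 − e1)·y·cos(y/2) ]². In particular G'(y)F(y) − G(y)F'(y) ≥ 0 for all real y. -/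
/-- Pontryagin positivity: for the real and imaginary parts `F, G` of
`Δ(iy)`, one has `G'F - GF' = 2[(y² + 4 e0 e1) sin(y/2) + 2(e0-e1) y cos(y/2)]² ≥ 0`. -/
theorem pontryagin_positivity (e0 e1 : ℝ) (F G : ℝ → ℝ)
    (hF : ∀ y : ℝ, F y =
      (y ^ 2 + 4 * e0 * e1) * (Real.cos y - 1) - 2 * (e0 - e1) * y * Real.sin y)
    (hG : ∀ y : ℝ, G y =
      (y ^ 2 + 4 * e0 * e1) * Real.sin y + 2 * (e0 - e1) * y * (1 + Real.cos y)) :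
    ∀ y : ℝ,
      deriv G y * F y - G y * deriv F y =
        2 * ((y ^ 2 + 4 * e0 * e1) * Real.sin (y / 2)
          + 2 * (e0 - e1) * y * Real.cos (y / 2)) ^ 2 ∧
      0 ≤ deriv G y * F y - G y * deriv F y := by
  intro y
  have hs : ∀ t : ℝ, Real.sin t = 2 * Real.sin (t / 2) * Real.cos (t / 2) := fun t => by
    rw [← Real.sin_two_mul]; congr 1; ring
  have hc : ∀ t : ℝ, Real.cos t = 2 * Real.cos (t / 2) ^ 2 - 1 := fun t => by
    rw [← Real.cos_two_mul]; congr 1; ring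
  obtain ⟨R, hR⟩ : ∃ R : ℝ → ℝ, R = fun t => (t ^ 2 + 4 * e0 * e1) * Real.sin (t / 2)
      + 2 * (e0 - e1) * t * Real.cos (t / 2) := ⟨_, rfl⟩
  have hF' : F = fun t => -2 * R t * Real.sin (t / 2) := by
    funext t
    rw [hF, hs t, hc t, hR]
    linear_combination (2 * (t ^ 2 + 4 * e0 * e1)) * Real.sin_sq_add_cos_sq (t / 2)
  have hG' : G = fun t => 2 * R t * Real.cos (t / 2) := by
    funext t
    rw [hG, hs t, hc t, hR]
    ring
  have hRd : HasDerivAt R (deriv R y) y := by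
    apply DifferentiableAt.hasDerivAt
    rw [hR]
    fun_prop
  have hh : HasDerivAt (fun t : ℝ => t / 2) (1 / 2) y := (hasDerivAt_id y).div_const 2
  have hFd := ((hRd.const_mul (-2)).mul hh.sin).deriv
  have hGd := ((hRd.const_mul 2).mul hh.cos).deriv
  have e1' : deriv F y = _ := (congrArg (fun f => deriv f y) hF').trans hFd
  have e2' : deriv G y = _ := (congrArg (fun f => deriv f y) hG').trans hGd
  have key : deriv G y * F y - G y * deriv F y = 2 * (R y) ^ 2 := by
    rw [e1', e2', hF', hG']
    linear_combination (2 * R y ^ 2) * Real.sin_sq_add_cos_sq (y / 2)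
  refine ⟨?_, ?_⟩
  · rw [key, hR]
  · rw [key]; positivity
end

section
/- Let e0, e1 be real numbers with e1 − e0 − e0·e1 > 0 and e1 − e0 > −2. Then every complex zero z of Δ(z) := (4·e0·e1 − z²)·(exp(z) − 1) − 2·(e1 − e0)·z·(exp(z) + 1) is purely imaginary, i.e., has real part equal to zero. Equivalently, every complex solution ω of the secular equation ((πω)² + e0·e1)·sin(πω) = (e1 − e0)·(πω)·cos(πω) is real, so the open string motion is stable. -/
open Real

/-- Energy argument for the Robin boundary value problem, in real coordinates. -/
lemma robin_energy (e0 e1 a b c : ℝ) (hD : 0 < e1 - e0 - e0 * e1) (h2 : -2 < e1 - e0)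
    (ur ui vr vi : ℝ → ℝ)
    (hur : ∀ x, HasDerivAt ur (vr x) x) (hui : ∀ x, HasDerivAt ui (vi x) x)
    (hvr : ∀ x, HasDerivAt vr (-(a * ur x - b * ui x)) x)
    (hvi : ∀ x, HasDerivAt vi (-(a * ui x + b * ur x)) x)
    (h0r : vr 0 = e1 * ur 0) (h0i : vi 0 = e1 * ui 0)
    (h1r : vr 1 = e0 * ur 1) (h1i : vi 1 = e0 * ui 1)
    (hc : a + c * b ≤ 0) : ur 0 = 0 ∧ ui 0 = 0 := by
  obtain ⟨dr, hdr⟩ : ∃ dr, dr = ur 1 - ur 0 := ⟨_, rfl⟩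
  obtain ⟨di, hdi⟩ : ∃ di, di = ui 1 - ui 0 := ⟨_, rfl⟩
  let H : ℝ → ℝ := fun x => ur x * vr x + ui x * vi x - 2 * (dr * ur x + di * ui x)
    + (dr ^ 2 + di ^ 2) * x + c * (ur x * vi x - ui x * vr x)
  have hH : ∀ x, HasDerivAt H ((vr x - dr) ^ 2 + (vi x - di) ^ 2
      - (a + c * b) * (ur x ^ 2 + ui x ^ 2)) x := by
    intro x
    have := (((((hur x).mul (hvr x)).add ((hui x).mul (hvi x))).sub
      ((((hur x).const_mul dr).add ((hui x).const_mul di)).const_mul 2)).add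
      ((hasDerivAt_id x).const_mul (dr ^ 2 + di ^ 2))).add
      ((((hur x).mul (hvi x)).sub ((hui x).mul (hvr x))).const_mul c)
    refine this.congr_deriv ?_
    ring
  have hmono : Monotone H := by
    refine monotone_of_deriv_nonneg (fun x => (hH x).differentiableAt) fun x => ?_
    rw [(hH x).deriv]
    linarith [sq_nonneg (vr x - dr), sq_nonneg (vi x - di),
      mul_nonneg (neg_nonneg.mpr hc) (add_nonneg (sq_nonneg (ur x)) (sq_nonneg (ui x)))]
  have h01 : H 0 ≤ H 1 := hmono zero_le_one
  simp only [H, h0r, h0i, h1r, h1i] at h01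
  -- the boundary form is positive definite
  have hA : 0 < 1 + e1 := by
    by_contra hn
    nlinarith [mul_nonneg (show 0 ≤ -(1 + e1) by linarith) (show 0 ≤ 1 - e0 by linarith)]
  have hB : 0 < 1 - e0 := by
    by_contra hn
    nlinarith [mul_nonneg (show 0 ≤ 1 + e1 by linarith) (show 0 ≤ -(1 - e0) by linarith)]
  have key : ∀ s t : ℝ, (1 - e0) * ((1 + e1) * s ^ 2 - 2 * s * t + (1 - e0) * t ^ 2)
      = (e1 - e0 - e0 * e1) * s ^ 2 + (s - (1 - e0) * t) ^ 2 := by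
    intro s t; ring
  have hq : ((1 + e1) * ur 0 ^ 2 - 2 * ur 0 * ur 1 + (1 - e0) * ur 1 ^ 2)
      + ((1 + e1) * ui 0 ^ 2 - 2 * ui 0 * ui 1 + (1 - e0) * ui 1 ^ 2) ≤ 0 := by
    subst hdr hdi
    linarith
  have hq2 := mul_nonneg hB.le (neg_nonneg.mpr hq)
  have k1 := key (ur 0) (ur 1)
  have k2 := key (ui 0) (ui 1)
  have hs : (e1 - e0 - e0 * e1) * (ur 0 ^ 2 + ui 0 ^ 2) ≤ 0 := by
    linarith [sq_nonneg (ur 0 - (1 - e0) * ur 1), sq_nonneg (ui 0 - (1 - e0) * ui 1)]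
  have hs2 : ur 0 ^ 2 + ui 0 ^ 2 ≤ 0 := by
    by_contra hn
    push Not at hn
    linarith [mul_pos hD hn]
  have n1 := sq_nonneg (ur 0)
  have n2 := sq_nonneg (ui 0)
  exact ⟨pow_eq_zero_iff two_ne_zero |>.mp (by linarith), pow_eq_zero_iff two_ne_zero |>.mp (by linarith)⟩

lemma secular_real (e0 e1 : ℝ) (hD : 0 < e1 - e0 - e0 * e1) (h2 : -2 < e1 - e0) (w : ℂ)
    (hw : (w ^ 2 + (e0 : ℂ) * (e1 : ℂ)) * Complex.sin w
      = ((e1 : ℂ) - (e0 : ℂ)) * w * Complex.cos w) : w.im = 0 := by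
  by_cases hw0 : w = 0
  · simp [hw0]
  let u : ℝ → ℂ := fun x => w * Complex.cos (w * x) + e1 * Complex.sin (w * x)
  let v : ℝ → ℂ := fun x => -w ^ 2 * Complex.sin (w * x) + e1 * w * Complex.cos (w * x)
  have hlin : ∀ y : ℂ, HasDerivAt (fun y : ℂ => w * y) w y := by
    intro y
    simpa using (hasDerivAt_id y).const_mul w
  have hcos : ∀ x : ℝ, HasDerivAt (fun x : ℝ => Complex.cos (w * (x : ℂ)))
      (-Complex.sin (w * x) * w) x := fun x =>
    (hlin x).ccos.comp_ofReal
  have hsin : ∀ x : ℝ, HasDerivAt (fun x : ℝ => Complex.sin (w * (x : ℂ)))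
      (Complex.cos (w * x) * w) x := fun x =>
    (hlin x).csin.comp_ofReal
  have hu : ∀ x, HasDerivAt u (v x) x := by
    intro x
    refine (((hcos x).const_mul w).add ((hsin x).const_mul (e1 : ℂ))).congr_deriv ?_
    simp only [v]; ring
  have hv : ∀ x, HasDerivAt v (-(w ^ 2 * u x)) x := by
    intro x
    refine (((hsin x).const_mul (-w ^ 2)).add ((hcos x).const_mul (e1 * w : ℂ))).congr_deriv ?_
    simp only [u]; ring
  have hre : ∀ {f : ℝ → ℂ} {f' : ℂ} {x : ℝ}, HasDerivAt f f' x →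
      HasDerivAt (fun x => (f x).re) f'.re x := fun {f f' x} h =>
    (Complex.reCLM.hasFDerivAt (x := f x)).comp_hasDerivAt x h
  have him : ∀ {f : ℝ → ℂ} {f' : ℂ} {x : ℝ}, HasDerivAt f f' x →
      HasDerivAt (fun x => (f x).im) f'.im x := fun {f f' x} h =>
    (Complex.imCLM.hasFDerivAt (x := f x)).comp_hasDerivAt x h
  have h0 : v 0 = e1 * u 0 := by simp [u, v]
  have h1 : v 1 = e0 * u 1 := by
    simp only [u, v, Complex.ofReal_one, mul_one]
    linear_combination -hw
  have hu0 : u 0 = w := by simp [u]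
  have main : ∀ c : ℝ, 0 < (w ^ 2).re + c * (w ^ 2).im := by
    intro c
    by_contra hn
    push Not at hn
    have := robin_energy e0 e1 (w ^ 2).re (w ^ 2).im c hD h2
      (fun x => (u x).re) (fun x => (u x).im) (fun x => (v x).re) (fun x => (v x).im)
      (fun x => hre (hu x)) (fun x => him (hu x))
      (fun x => (hre (hv x)).congr_deriv (by rw [Complex.neg_re, Complex.mul_re]))
      (fun x => (him (hv x)).congr_deriv (by rw [Complex.neg_im, Complex.mul_im]))
      (by simp [h0]) (by simp [h0]) (by simp [h1]) (by simp [h1]) hn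
    simp only [hu0] at this
    exact hw0 (Complex.ext this.1 this.2)
  have hpos := main 0
  have him0 : (w ^ 2).im = 0 := by
    by_contra hb
    have := main (-(w ^ 2).re / (w ^ 2).im)
    rw [div_mul_cancel₀ _ hb] at this
    linarith
  rw [pow_two, Complex.mul_im] at him0
  rw [pow_two, Complex.mul_re] at hpos
  have hprod : w.re * w.im = 0 := by linarith
  rcases mul_eq_zero.mp hprod with h | h
  · rw [h] at hpos
    nlinarith [sq_nonneg w.im]
  · exact h

/-- Stability region: if `D = e1 - e0 - e0·e1 > 0` and `e1 - e0 > -2`, then all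
zeros of the characteristic function `Δ` are purely imaginary; equivalently all
complex solutions of the secular equation are real. -/
theorem stability_region_all_roots_real (e0 e1 : ℝ)
    (hD : 0 < e1 - e0 - e0 * e1) (h2 : -2 < e1 - e0) :
    (∀ z : ℂ,
        (4 * (e0 : ℂ) * (e1 : ℂ) - z ^ 2) * (Complex.exp z - 1)
            - 2 * ((e1 : ℂ) - (e0 : ℂ)) * z * (Complex.exp z + 1) = 0 →
        z.re = 0) ∧
    (∀ ω : ℂ,
        (((π : ℂ) * ω) ^ 2 + (e0 : ℂ) * (e1 : ℂ)) * Complex.sin ((π : ℂ) * ω)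
            = ((e1 : ℂ) - (e0 : ℂ)) * ((π : ℂ) * ω) * Complex.cos ((π : ℂ) * ω) →
        ω.im = 0) := by
  refine ⟨fun z hz => ?_, fun ω hω => ?_⟩
  · obtain ⟨w, rfl⟩ : ∃ w : ℂ, z = 2 * (Complex.I * w) :=
      ⟨-Complex.I * z / 2, by linear_combination z * Complex.I_mul_I⟩
    have hI := Complex.I_mul_I
    have hexp : Complex.exp (2 * (Complex.I * w))
        = (Complex.cos w + Complex.sin w * Complex.I) ^ 2 := by
      rw [← Complex.exp_mul_I, ← Complex.exp_nat_mul]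
      congr 1
      push_cast; ring
    have hE : Complex.cos w + Complex.sin w * Complex.I ≠ 0 := by
      rw [← Complex.exp_mul_I]; exact Complex.exp_ne_zero _
    have hcs := Complex.sin_sq_add_cos_sq w
    have hm : Complex.exp (2 * (Complex.I * w)) - 1
        = (Complex.cos w + Complex.sin w * Complex.I) * (2 * Complex.I * Complex.sin w) := by
      rw [hexp]; linear_combination hcs - Complex.sin w ^ 2 * hI
    have hp : Complex.exp (2 * (Complex.I * w)) + 1
        = (Complex.cos w + Complex.sin w * Complex.I) * (2 * Complex.cos w) := by
      rw [hexp]; linear_combination -hcs + Complex.sin w ^ 2 * hI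
    rw [hm, hp] at hz
    have hz2 : (8 * Complex.I * (Complex.cos w + Complex.sin w * Complex.I)) *
        ((w ^ 2 + (e0 : ℂ) * (e1 : ℂ)) * Complex.sin w
          - ((e1 : ℂ) - (e0 : ℂ)) * w * Complex.cos w) = 0 := by
      linear_combination hz + 8 * w ^ 2 * Complex.I * Complex.sin w *
        (Complex.cos w + Complex.sin w * Complex.I) * hI
    have h8 : 8 * Complex.I * (Complex.cos w + Complex.sin w * Complex.I) ≠ 0 :=
      mul_ne_zero (mul_ne_zero (by norm_num) Complex.I_ne_zero) hE
    have := secular_real e0 e1 hD h2 w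
      (sub_eq_zero.mp ((mul_eq_zero.mp hz2).resolve_left h8))
    simp [this]
  · have := secular_real e0 e1 hD h2 (π * ω) hω
    rw [Complex.im_ofReal_mul] at this
    exact (mul_eq_zero.mp this).resolve_left Real.pi_ne_zero
end

section
/- Let e0, e1 be real numbers with e1 − e0 − e0·e1 < 0. Then the function Δ(z) := (4·e0·e1 − z²)·(exp(z) − 1) − 2·(e1 − e0)·z·(exp(z) + 1) has a zero on the strictly positive real axis, i.e., there exists a real x > 0 with Δ(x) = 0. (When D < 0 the open string has an unstable mode with purely imaginary frequency.) -/
/-- Instability region: if `D = e1 - e0 - e0·e1 < 0`, the characteristic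
function `Δ` has a zero on the strictly positive real axis. -/
theorem instability_real_zero (e0 e1 : ℝ) (hD : e1 - e0 - e0 * e1 < 0) :
    ∃ x : ℝ, 0 < x ∧
      (4 * e0 * e1 - x ^ 2) * (Real.exp x - 1)
        - 2 * (e1 - e0) * x * (Real.exp x + 1) = 0 := by
  set f : ℝ → ℝ := fun x => (4 * e0 * e1 - x ^ 2) * (Real.exp x - 1)
        - 2 * (e1 - e0) * x * (Real.exp x + 1) with hf
  have hder : HasDerivAt f (4 * e0 * e1 - 4 * (e1 - e0)) 0 := by
    have h1 : HasDerivAt (fun x : ℝ => 4 * e0 * e1 - x ^ 2) 0 0 := by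
      simpa using ((hasDerivAt_pow 2 (0:ℝ)).const_sub (4 * e0 * e1))
    have h2 : HasDerivAt (fun x : ℝ => 2 * (e1 - e0) * x) (2 * (e1 - e0)) 0 := by
      simpa using ((hasDerivAt_id (0:ℝ)).const_mul (2 * (e1 - e0)))
    have h3 := Real.hasDerivAt_exp 0
    have h4 := (h1.mul (h3.sub_const 1)).sub (h2.mul (h3.add_const 1))
    refine h4.congr_deriv ?_
    simp
    ring
  have hev : ∀ᶠ x in nhdsWithin (0:ℝ) (Set.Ioi 0), 0 < slope f 0 x := by
    have h := hasDerivAt_iff_tendsto_slope.1 hder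
    have h' := h.mono_left (nhdsWithin_mono (0:ℝ)
      (fun x (hx : x ∈ Set.Ioi (0:ℝ)) => (ne_of_gt hx : x ≠ 0)))
    exact h'.eventually (lt_mem_nhds (by linarith))
  obtain ⟨a, hsl, ha0, ha1⟩ :=
    (hev.and (Ioo_mem_nhdsGT (show (0:ℝ) < 1 by norm_num))).exists
  have hfa : 0 < f a := by
    have h0 : f 0 = 0 := by simp [hf]
    rw [slope_def_field, h0, sub_zero, sub_zero] at hsl
    exact (div_pos_iff_of_pos_right ha0).1 hsl
  obtain ⟨b, hb⟩ : ∃ b : ℝ, b = 1 + 4 * |e0 * e1| + 6 * |e1 - e0| := ⟨_, rfl⟩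
  have hp := abs_nonneg (e0 * e1)
  have hd := abs_nonneg (e1 - e0)
  have hp' := le_abs_self (e0 * e1)
  have hd' := neg_abs_le (e1 - e0)
  have hb1 : 1 ≤ b := by linarith
  have hfb : f b < 0 := by
    have hE : 2 ≤ Real.exp b := by linarith [Real.add_one_le_exp b]
    have hq : 0 < b ^ 2 - 4 * (e0 * e1) - 6 * |e1 - e0| * b := by
      have : b ^ 2 = b + 4 * |e0 * e1| * b + 6 * |e1 - e0| * b := by
        rw [pow_two]; nth_rewrite 1 [hb]; ring
      nlinarith [mul_nonneg hp (sub_nonneg.2 hb1)]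
    have k1 := mul_pos hq (show 0 < Real.exp b - 1 by linarith)
    have k2 : 0 ≤ (|e1 - e0| + (e1 - e0)) * (b * (Real.exp b + 1)) :=
      mul_nonneg (by linarith) (by positivity)
    have k3 : 0 ≤ |e1 - e0| * b * (2 * Real.exp b - 4) :=
      mul_nonneg (by positivity) (by linarith)
    simp only [hf]
    nlinarith
  have hc : ContinuousOn f (Set.Icc a b) := by
    apply Continuous.continuousOn
    rw [hf]
    fun_prop
  obtain ⟨x, hx, hx0⟩ := intermediate_value_Icc' (by linarith : a ≤ b) hc ⟨hfb.le, hfa.le⟩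
  exact ⟨x, lt_of_lt_of_le ha0 hx.1, hx0⟩
end

section
/- Let b, e0, e1 be real numbers. For every complex number ω, the determinant of the 2×2 complex matrix M(ω) := [[−(i + b)·πω + e0, (i − b)·πω + e0], [(−(i + b)·πω + e1)·exp(−2iπω), (i − b)·πω + e1]] satisfies exp(iπω)·det M(ω) = 2i·[ ((1 + b²)·(πω)² − b·(e0 + e1)·(πω) + e0·e1)·sin(πω) + (e0 − e1)·(πω)·cos(πω) ]. In particular the eigenfrequencies of one circular polarization satisfy tan(πω) = (e1 − e0)·(πω) / ((1 + b²)·(πω)² − b·(e0 + e1)·(πω) + e0·e1) whenever the expressions are defined. -/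
open Real

/-- Secular determinant identity for an open string in a quadrupolar electric
field with a transverse magnetic field `b` (Penning trap):
`e^{iπω} det M(ω) = 2i[((1+b²)(πω)² - b(e0+e1)(πω) + e0 e1) sin(πω)
  + (e0-e1)(πω) cos(πω)]`. -/
theorem penning_open_string_secular (b e0 e1 : ℝ) :
    let M : ℂ → Matrix (Fin 2) (Fin 2) ℂ := fun ω =>
      !![-((Complex.I + (b : ℂ)) * ((π : ℂ) * ω)) + (e0 : ℂ),
         (Complex.I - (b : ℂ)) * ((π : ℂ) * ω) + (e0 : ℂ);
         (-((Complex.I + (b : ℂ)) * ((π : ℂ) * ω)) + (e1 : ℂ)) *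
            Complex.exp (-(2 * Complex.I * (π : ℂ) * ω)),
         (Complex.I - (b : ℂ)) * ((π : ℂ) * ω) + (e1 : ℂ)]
    ∀ ω : ℂ, Complex.exp (Complex.I * (π : ℂ) * ω) * (M ω).det =
      2 * Complex.I *
        (((1 + (b : ℂ) ^ 2) * ((π : ℂ) * ω) ^ 2
            - (b : ℂ) * ((e0 : ℂ) + (e1 : ℂ)) * ((π : ℂ) * ω)
            + (e0 : ℂ) * (e1 : ℂ)) * Complex.sin ((π : ℂ) * ω)
          + ((e0 : ℂ) - (e1 : ℂ)) * ((π : ℂ) * ω) * Complex.cos ((π : ℂ) * ω)) := by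
  intro M ω
  have h1 : Complex.exp (Complex.I * (π : ℂ) * ω)
      = Complex.cos ((π : ℂ) * ω) + Complex.sin ((π : ℂ) * ω) * Complex.I := by
    rw [← Complex.exp_mul_I]; congr 1; ring
  have h2 : Complex.exp (Complex.I * (π : ℂ) * ω) *
      Complex.exp (-(2 * Complex.I * (π : ℂ) * ω))
      = Complex.cos ((π : ℂ) * ω) - Complex.sin ((π : ℂ) * ω) * Complex.I := by
    rw [← Complex.exp_add]
    have h3 := Complex.exp_mul_I (-((π : ℂ) * ω))
    rw [Complex.cos_neg, Complex.sin_neg] at h3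
    rw [neg_mul (Complex.sin _), ← sub_eq_add_neg] at h3
    rw [← h3]; congr 1; ring
  have hI : Complex.I ^ 2 = -1 := Complex.I_sq
  simp only [M, Matrix.det_fin_two_of]
  generalize Complex.exp (Complex.I * (π : ℂ) * ω) = E at *
  generalize Complex.exp (-(2 * Complex.I * (π : ℂ) * ω)) = F at *
  generalize Complex.cos ((π : ℂ) * ω) = c at *
  generalize Complex.sin ((π : ℂ) * ω) = s at *
  generalize (π : ℂ) * ω = x at *
  generalize Complex.I = i at *
  linear_combination (-((i + b) * x) + e0) * ((i - b) * x + e1) * h1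
    - ((i - b) * x + e0) * (-((i + b) * x) + e1) * h2
    - 2 * s * i * x ^ 2 * hI
end

section
/- Let e0, e1 be real numbers, and let ω, ω' be nonzero complex numbers with ω + ω' ≠ 0, with iπω + e0 ≠ 0 and iπω' + e0 ≠ 0, each satisfying the secular equation ((πω)² + e0·e1)·sin(πω) = (e1 − e0)·(πω)·cos(πω). Define the mode function Y_ω(τ, σ) := (i/ω)·( exp(−iω(τ + σ)) + ((iπω − e0)/(iπω + e0))·exp(−iω(τ − σ)) ), and similarly Y_{ω'}. Then for every real τ, the symplectic pairing ∫₀^π ( Y_ω(τ,σ)·∂τY_{ω'}(τ,σ) − Y_{ω'}(τ,σ)·∂τY_ω(τ,σ) ) dσ = 0. (Eigenmodes with ω' ≠ −ω are symplectically orthogonal.) -/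
open Real

/-- derivative in real time and space of the plane-wave combination -/
lemma mode_deriv_tau (w r c : ℂ) (σ τ : ℝ) :
    HasDerivAt (fun t : ℝ => c * (Complex.exp (-(Complex.I * w * ((t : ℂ) + (σ : ℂ))))
        + r * Complex.exp (-(Complex.I * w * ((t : ℂ) - (σ : ℂ))))))
      (-(Complex.I * w) * (c * (Complex.exp (-(Complex.I * w * ((τ : ℂ) + (σ : ℂ))))
        + r * Complex.exp (-(Complex.I * w * ((τ : ℂ) - (σ : ℂ))))))) τ := by
  have h0 : HasDerivAt (fun t : ℝ => (t : ℂ)) 1 τ := Complex.ofRealCLM.hasDerivAt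
  have h1 := (((h0.add_const (σ : ℂ)).const_mul (Complex.I * w)).fun_neg).cexp
  have h2 := (((h0.sub_const (σ : ℂ)).const_mul (Complex.I * w)).fun_neg).cexp
  refine ((h1.fun_add (h2.const_mul r)).const_mul c).congr_deriv ?_
  ring

lemma mode_deriv_sigma (w r c : ℂ) (σ τ : ℝ) :
    HasDerivAt (fun s : ℝ => c * (Complex.exp (-(Complex.I * w * ((τ : ℂ) + (s : ℂ))))
        + r * Complex.exp (-(Complex.I * w * ((τ : ℂ) - (s : ℂ))))))
      (-(Complex.I * w) * c * (Complex.exp (-(Complex.I * w * ((τ : ℂ) + (σ : ℂ))))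
        + (-r) * Complex.exp (-(Complex.I * w * ((τ : ℂ) - (σ : ℂ)))))) σ := by
  have h0 : HasDerivAt (fun t : ℝ => (t : ℂ)) 1 σ := Complex.ofRealCLM.hasDerivAt
  have h1 := (((h0.const_add (τ : ℂ)).const_mul (Complex.I * w)).fun_neg).cexp
  have h2 := (((h0.const_sub (τ : ℂ)).const_mul (Complex.I * w)).fun_neg).cexp
  refine ((h1.fun_add (h2.const_mul r)).const_mul c).congr_deriv ?_
  ring

lemma robin_zero (e0 : ℝ) (w c : ℂ) (τ : ℝ)
    (hden : Complex.I * (π : ℂ) * w + (e0 : ℂ) ≠ 0) :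
    (-(Complex.I * w) * c * (Complex.exp (-(Complex.I * w * ((τ : ℂ) + ((0 : ℝ) : ℂ))))
        + (-((Complex.I * (π : ℂ) * w - (e0 : ℂ)) / (Complex.I * (π : ℂ) * w + (e0 : ℂ))))
          * Complex.exp (-(Complex.I * w * ((τ : ℂ) - ((0 : ℝ) : ℂ))))))
    = -((e0 : ℂ) / π) * (c * (Complex.exp (-(Complex.I * w * ((τ : ℂ) + ((0 : ℝ) : ℂ))))
        + ((Complex.I * (π : ℂ) * w - (e0 : ℂ)) / (Complex.I * (π : ℂ) * w + (e0 : ℂ)))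
          * Complex.exp (-(Complex.I * w * ((τ : ℂ) - ((0 : ℝ) : ℂ)))))) := by
  have hpi : (π : ℂ) ≠ 0 := by exact_mod_cast Real.pi_ne_zero
  simp only [Complex.ofReal_zero, add_zero, sub_zero]
  have hr : (Complex.I * (π : ℂ) * w - (e0 : ℂ)) / (Complex.I * (π : ℂ) * w + (e0 : ℂ))
      * (Complex.I * (π : ℂ) * w + (e0 : ℂ)) = Complex.I * (π : ℂ) * w - (e0 : ℂ) :=
    div_mul_cancel₀ _ hden
  have hq : (e0 : ℂ) / (π : ℂ) * π = e0 := div_mul_cancel₀ _ hpi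
  generalize (Complex.I * (π : ℂ) * w - (e0 : ℂ)) / (Complex.I * (π : ℂ) * w + (e0 : ℂ)) = r at *
  generalize (e0 : ℂ) / (π : ℂ) = q at *
  generalize Complex.exp (-(Complex.I * w * τ)) = E
  apply mul_left_cancel₀ (mul_ne_zero hpi hden)
  linear_combination (c * E * (Complex.I * w * π + q * π)) * hr
    + c * E * (2 * Complex.I * π * w) * hq

lemma robin_pi (e0 e1 : ℝ) (w c : ℂ) (τ : ℝ)
    (hden : Complex.I * (π : ℂ) * w + (e0 : ℂ) ≠ 0)
    (hsec : (((π : ℂ) * w) ^ 2 + (e0 : ℂ) * (e1 : ℂ)) * Complex.sin ((π : ℂ) * w)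
      = ((e1 : ℂ) - (e0 : ℂ)) * ((π : ℂ) * w) * Complex.cos ((π : ℂ) * w)) :
    (-(Complex.I * w) * c * (Complex.exp (-(Complex.I * w * ((τ : ℂ) + (π : ℂ))))
        + (-((Complex.I * (π : ℂ) * w - (e0 : ℂ)) / (Complex.I * (π : ℂ) * w + (e0 : ℂ))))
          * Complex.exp (-(Complex.I * w * ((τ : ℂ) - (π : ℂ))))))
    = -((e1 : ℂ) / π) * (c * (Complex.exp (-(Complex.I * w * ((τ : ℂ) + (π : ℂ))))
        + ((Complex.I * (π : ℂ) * w - (e0 : ℂ)) / (Complex.I * (π : ℂ) * w + (e0 : ℂ)))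
          * Complex.exp (-(Complex.I * w * ((τ : ℂ) - (π : ℂ)))))) := by
  have hpi : (π : ℂ) ≠ 0 := by exact_mod_cast Real.pi_ne_zero
  have hA : Complex.exp (-(Complex.I * w * ((τ : ℂ) + (π : ℂ))))
      = Complex.exp (-(Complex.I * w * τ))
        * (Complex.cos (π * w) - Complex.sin (π * w) * Complex.I) := by
    have h := Complex.exp_mul_I (-((π : ℂ) * w))
    rw [Complex.cos_neg, Complex.sin_neg, neg_mul, neg_mul, ← sub_eq_add_neg] at h
    rw [← h, ← Complex.exp_add]
    congr 1; ring
  have hB : Complex.exp (-(Complex.I * w * ((τ : ℂ) - (π : ℂ))))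
      = Complex.exp (-(Complex.I * w * τ))
        * (Complex.cos (π * w) + Complex.sin (π * w) * Complex.I) := by
    rw [← Complex.exp_mul_I, ← Complex.exp_add]
    congr 1; ring
  rw [hA, hB]
  have hr : (Complex.I * (π : ℂ) * w - (e0 : ℂ)) / (Complex.I * (π : ℂ) * w + (e0 : ℂ))
      * (Complex.I * (π : ℂ) * w + (e0 : ℂ)) = Complex.I * (π : ℂ) * w - (e0 : ℂ) :=
    div_mul_cancel₀ _ hden
  have hq : (e1 : ℂ) / (π : ℂ) * π = e1 := div_mul_cancel₀ _ hpi
  generalize (Complex.I * (π : ℂ) * w - (e0 : ℂ)) / (Complex.I * (π : ℂ) * w + (e0 : ℂ)) = r at *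
  generalize (e1 : ℂ) / (π : ℂ) = q at *
  clear hA hB
  generalize Complex.exp (-(Complex.I * w * τ)) = T
  generalize Complex.cos (π * w) = C at *
  generalize Complex.sin (π * w) = S at *
  have hI := Complex.I_sq
  generalize Complex.I = I at *
  generalize (π : ℂ) = p at *
  apply mul_left_cancel₀ (mul_ne_zero hpi hden)
  linear_combination (c * (T * (C + S * I)) * (I * w * p + q * p)) * hr
    + c * (T * (C - S * I) * (I * p * w + e0) + T * (C + S * I) * (I * p * w - e0)) * hq
    - 2 * I * c * T * hsec + 2 * I * (p * w) ^ 2 * S * c * T * hI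

/-- Symplectic orthogonality of open string eigenmodes: two modes `Y_ω`, `Y_ω'`
with `ω, ω' ≠ 0`, `ω + ω' ≠ 0`, both satisfying the secular equation, have
vanishing symplectic pairing `∫₀^π (Y_ω ∂τ Y_ω' - Y_ω' ∂τ Y_ω) dσ = 0`. -/
theorem eigenmode_symplectic_orthogonality (e0 e1 : ℝ) (ω ω' : ℂ)
    (hω : ω ≠ 0) (hω' : ω' ≠ 0) (hsum : ω + ω' ≠ 0)
    (hden : Complex.I * (π : ℂ) * ω + (e0 : ℂ) ≠ 0)
    (hden' : Complex.I * (π : ℂ) * ω' + (e0 : ℂ) ≠ 0)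
    (hsec : (((π : ℂ) * ω) ^ 2 + (e0 : ℂ) * (e1 : ℂ)) * Complex.sin ((π : ℂ) * ω)
      = ((e1 : ℂ) - (e0 : ℂ)) * ((π : ℂ) * ω) * Complex.cos ((π : ℂ) * ω))
    (hsec' : (((π : ℂ) * ω') ^ 2 + (e0 : ℂ) * (e1 : ℂ)) * Complex.sin ((π : ℂ) * ω')
      = ((e1 : ℂ) - (e0 : ℂ)) * ((π : ℂ) * ω') * Complex.cos ((π : ℂ) * ω')) :
    let Y : ℂ → ℝ → ℝ → ℂ := fun w τ σ =>
      (Complex.I / w) * (Complex.exp (-(Complex.I * w * ((τ : ℂ) + (σ : ℂ))))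
        + ((Complex.I * (π : ℂ) * w - (e0 : ℂ)) / (Complex.I * (π : ℂ) * w + (e0 : ℂ)))
            * Complex.exp (-(Complex.I * w * ((τ : ℂ) - (σ : ℂ)))))
    ∀ τ : ℝ,
      (∫ σ in (0 : ℝ)..π,
        (Y ω τ σ * deriv (fun t => Y ω' t σ) τ
          - Y ω' τ σ * deriv (fun t => Y ω t σ) τ)) = 0 := by
  intro Y τ
  let Z : ℂ → ℝ → ℂ := fun w σ => -(Complex.I * w) * (Complex.I / w) *
      (Complex.exp (-(Complex.I * w * ((τ : ℂ) + (σ : ℂ))))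
        + (-((Complex.I * (π : ℂ) * w - (e0 : ℂ)) / (Complex.I * (π : ℂ) * w + (e0 : ℂ))))
            * Complex.exp (-(Complex.I * w * ((τ : ℂ) - (σ : ℂ)))))
  have hτ : ∀ w σ, deriv (fun t => Y w t σ) τ = -(Complex.I * w) * Y w τ σ := fun w σ =>
    (mode_deriv_tau w _ _ σ τ).deriv
  have hY : ∀ w σ, HasDerivAt (fun s => Y w τ s) (Z w σ) σ := fun w σ =>
    mode_deriv_sigma w _ _ σ τ
  have hZ : ∀ w σ, HasDerivAt (fun s => Z w s) (-w ^ 2 * Y w τ σ) σ := fun w σ => by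
    refine (mode_deriv_sigma w _ _ σ τ).congr_deriv ?_
    simp only [Y, neg_neg]
    linear_combination (w ^ 2 * (Y w τ σ)) * Complex.I_sq
  have h0 : ∀ w, Complex.I * (π : ℂ) * w + (e0 : ℂ) ≠ 0 →
      Z w 0 = -((e0 : ℂ) / π) * Y w τ 0 := fun w h => robin_zero e0 w _ τ h
  have hp := robin_pi e0 e1 ω (Complex.I / ω) τ hden hsec
  have hp' := robin_pi e0 e1 ω' (Complex.I / ω') τ hden' hsec'
  change Z ω π = -((e1 : ℂ) / π) * Y ω τ π at hp
  change Z ω' π = -((e1 : ℂ) / π) * Y ω' τ π at hp'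
  have hF : ∀ σ : ℝ, HasDerivAt
      (fun s => Complex.I / (ω + ω') * (Y ω τ s * Z ω' s - Z ω s * Y ω' τ s))
      (Y ω τ σ * (-(Complex.I * ω') * Y ω' τ σ)
          - Y ω' τ σ * (-(Complex.I * ω) * Y ω τ σ)) σ := fun σ => by
    refine ((((hY ω σ).fun_mul (hZ ω' σ)).fun_sub
      ((hZ ω σ).fun_mul (hY ω' σ))).const_mul _).congr_deriv ?_
    field_simp
    ring
  have hYc : ∀ w, Continuous (fun s => Y w τ s) := fun w =>
    continuous_iff_continuousAt.2 fun σ => (hY w σ).continuousAt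
  simp only [hτ]
  rw [intervalIntegral.integral_eq_sub_of_hasDerivAt (fun σ _ => hF σ)
    (Continuous.intervalIntegrable
      (((hYc ω).mul (continuous_const.mul (hYc ω'))).sub
        ((hYc ω').mul (continuous_const.mul (hYc ω)))) _ _)]
  rw [hp, hp', h0 ω hden, h0 ω' hden']
  ring
end
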